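/- arXiv:1502.00426 — 2 statements merged into one kernel-verified Lean document; each statement's English description precedes it below -/
import Mathlib

section
/- Define polynomials P_n(β) := Σ_{k=0}^{n−1} N(n,k)·(1+β)^k, where N(n,k) = (1/n)·C(n,k)·C(n,k+1) are the Narayana numbers, for n ≥ 1. Then for all n ≥ 1 the recurrence P_{n+1}(β) = (2+β)·P_n(β) + (1+β)·Σ_{k=1}^{n−1} P_k(β)·P_{n−k}(β) holds as an identity of polynomials in β. -/
open Polynomial in
/-- Narayana polynomial in the variable `1 + β`. -/
noncomputable def nar (n : ℕ) : ℚ[X] := ∑ k ∈ Finset.range n,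
  C ((1 : ℚ) / n * (n.choose k : ℚ) * (n.choose (k + 1) : ℚ)) * X ^ k

open Polynomial in
theorem nar_coeff (n k : ℕ) :
    (nar n).coeff k = (1 : ℚ) / n * (n.choose k : ℚ) * (n.choose (k + 1) : ℚ) := by
  unfold nar
  simp only [finsetSum_coeff, coeff_C_mul, coeff_X_pow]
  simp only [mul_ite, mul_one, mul_zero, Finset.sum_ite_eq, Finset.mem_range]
  split_ifs with h
  · rfl
  · rw [Nat.choose_eq_zero_of_lt (show n < k + 1 by omega)]; simp

theorem choose_step (n k : ℕ) :
    (n.choose (k + 1) : ℚ) = n.choose k * ((n : ℚ) - k) / (k + 1) := by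
  have hk : (k : ℚ) + 1 ≠ 0 := by positivity
  rw [eq_div_iff hk]
  rcases le_or_gt k n with h | h
  · have := Nat.choose_succ_right_eq n k
    have h2 : ((n - k : ℕ) : ℚ) = (n : ℚ) - k := by push_cast [h]; ring
    rw [← h2]
    exact_mod_cast this
  · rw [Nat.choose_eq_zero_of_lt h, Nat.choose_eq_zero_of_lt (by omega : n < k + 1)]; simp

theorem n_nar_coeff (n k : ℕ) :
    (n : ℚ) * (nar n).coeff k = (n.choose k : ℚ) * (n.choose (k + 1) : ℚ) := by
  rw [nar_coeff]
  rcases Nat.eq_zero_or_pos n with h | h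
  · subst h; simp
  · have : (n : ℚ) ≠ 0 := by positivity
    field_simp

open Polynomial in
theorem nar_rec (n : ℕ) :
    ((n : ℚ[X]) + 3) * nar (n + 2) =
      (2 * (n : ℚ[X]) + 3) * (1 + X) * nar (n + 1) - (n : ℚ[X]) * (1 - X) ^ 2 * nar n := by
  have e : (n : ℚ[X]) = C (n : ℚ) := by simp
  have e1 : ((n : ℚ[X]) + 3) * nar (n + 2) = C ((n : ℚ) + 3) * nar (n + 2) := by
    rw [C_add, ← e, C_ofNat]
  have e2 : (2 * (n : ℚ[X]) + 3) * (1 + X) * nar (n + 1) - (n : ℚ[X]) * (1 - X) ^ 2 * nar n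
     = C (2 * (n : ℚ) + 3) * nar (n + 1) + C (2 * (n : ℚ) + 3) * (X * nar (n + 1))
       - C (n : ℚ) * nar n + C 2 * (C (n : ℚ) * (X * nar n))
       - C (n : ℚ) * (X * (X * nar n)) := by
    simp only [C_add, C_mul, C_ofNat, ← e]; ring
  rw [e1, e2]
  have h1 : (n : ℚ) + 1 ≠ 0 := by positivity
  have h2 : (n : ℚ) + 2 ≠ 0 := by positivity
  ext k
  simp only [coeff_add, coeff_sub, coeff_C_mul]
  rcases k with _ | _ | k
  · simp only [coeff_X_mul_zero, n_nar_coeff]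
    simp only [nar_coeff]
    simp
    field_simp
    ring
  · simp only [coeff_X_mul, coeff_X_mul_zero, n_nar_coeff]
    simp only [nar_coeff, choose_step]
    simp
    field_simp
    ring
  · simp only [coeff_X_mul, n_nar_coeff]
    simp only [nar_coeff, Nat.choose_succ_succ' (n + 1), Nat.choose_succ_succ' n]
    push_cast
    have hb := choose_step n k
    have hc := choose_step n (k + 1)
    have hd := choose_step n (k + 1 + 1)
    rw [hd, hc, hb]
    push_cast
    have k1 : (k : ℚ) + 1 ≠ 0 := by positivity
    have k2 : (k : ℚ) + 1 + 1 ≠ 0 := by positivity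
    have k3 : (k : ℚ) + 1 + 1 + 1 ≠ 0 := by positivity
    have h2' : (n : ℚ) + 1 + 1 ≠ 0 := by positivity
    field_simp
    ring

open PowerSeries in
theorem ode_zero {R : Type*} [CommRing R] [IsDomain R] [CharZero R] (a b : R) (W : R⟦X⟧)
    (h0 : coeff 0 W = 0)
    (h : (1 + C a * X + C b * X ^ 2) * d⁄dX R W = (C a + C (2 * b) * X) * W) : W = 0 := by
  have h' : d⁄dX R W + C a * (X * d⁄dX R W) + C b * (X * (X * d⁄dX R W))
      = C a * W + C (2 * b) * (X * W) := by linear_combination h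
  have key : ∀ n, coeff n W = 0 ∧ coeff (n + 1) W = 0 := by
    intro n
    induction n with
    | zero =>
      refine ⟨h0, ?_⟩
      have := congrArg (coeff 0) h'
      simp only [map_add, coeff_C_mul, coeff_zero_X_mul, coeff_derivative, h0] at this
      simpa using this
    | succ n ih =>
      refine ⟨ih.2, ?_⟩
      have := congrArg (coeff (n + 1)) h'
      rcases n with _ | n
      · simp only [map_add, coeff_C_mul, coeff_succ_X_mul, coeff_zero_X_mul, coeff_derivative,
          ih.1, ih.2] at this
        have h2 : ((0 + 1 : ℕ) : R) + 1 ≠ 0 := by norm_num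
        simp only [mul_zero, zero_mul, add_zero] at this
        exact (mul_eq_zero.mp this).resolve_right h2
      · simp only [map_add, coeff_C_mul, coeff_succ_X_mul, coeff_derivative,
          ih.1, ih.2] at this
        have h2 : ((n + 1 + 1 : ℕ) : R) + 1 ≠ 0 := by exact_mod_cast Nat.succ_ne_zero (n + 1 + 1)
        simp only [mul_zero, zero_mul, add_zero] at this
        exact (mul_eq_zero.mp this).resolve_right h2
  ext n
  simpa using (key n).1

theorem nar_zero : nar 0 = 0 := by simp [nar]
theorem nar_one : nar 1 = 1 := by simp [nar]

open PowerSeries in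
theorem nar_gf (F : (Polynomial ℚ)⟦X⟧) (hF : F = PowerSeries.mk nar)
    (y : Polynomial ℚ) (hy : y = Polynomial.X) (u v : Polynomial ℚ)
    (hu : u = 1 + y) (hv : v = (1 - y) ^ 2) :
    F = X + C u * (X * F) + C y * (X * (F * F)) := by
  have cF : ∀ n, coeff n F = nar n := by intro n; rw [hF, coeff_mk]
  -- linear ODE for F, times X
  have hode : X * d⁄dX _ F + F - C (2 * u) * (X * (X * d⁄dX _ F)) - C u * (X * F)
      + C v * (X * (X * (X * d⁄dX _ F))) = 2 * X := by
    have e2 : (2 : (Polynomial ℚ)⟦X⟧) = C 2 := (map_ofNat _ 2).symm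
    rw [e2]
    ext1 n
    rcases n with _ | _ | _ | n
    · simp only [map_add, map_sub, coeff_C_mul, coeff_zero_X_mul, cF, nar_zero, coeff_zero_X]
      simp
    · simp only [map_add, map_sub, coeff_C_mul, coeff_succ_X_mul, coeff_zero_X_mul,
        coeff_derivative, cF, nar_zero, nar_one, zero_add, coeff_one_X]
      simp
      norm_num
    · have := nar_rec 0
      simp only [map_add, map_sub, coeff_C_mul, coeff_succ_X_mul, coeff_zero_X_mul,
        coeff_derivative, cF, nar_zero, nar_one, zero_add, coeff_X] at this ⊢
      simp at this ⊢
      subst hu hv hy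
      linear_combination 3 * this
    · have := nar_rec (n + 1)
      simp only [map_add, map_sub, coeff_C_mul, coeff_succ_X_mul, coeff_zero_X_mul,
        coeff_derivative, cF, coeff_X] at this ⊢
      simp at this ⊢
      subst hu hv hy
      linear_combination this
  have Cu : (C u : (Polynomial ℚ)⟦X⟧) = 1 + C y := by rw [hu, map_add, map_one]
  have Cv : (C v : (Polynomial ℚ)⟦X⟧) = (1 - C y) ^ 2 := by rw [hv, map_pow, map_sub, map_one]
  have C2 : (C (2 : Polynomial ℚ) : (Polynomial ℚ)⟦X⟧) = 2 := map_ofNat _ 2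
  set S : (Polynomial ℚ)⟦X⟧ := 1 - C u * X - 2 * C y * (X * F) with hS
  have dS : d⁄dX _ S = - C u - 2 * C y * (F + X * d⁄dX _ F) := by
    have e2 : (2 : (Polynomial ℚ)⟦X⟧) = C 2 := (map_ofNat _ 2).symm
    rw [hS, e2]
    simp only [map_sub, Derivation.leibniz, derivative_C, derivative_X, smul_eq_mul,
      Derivation.map_one_eq_zero]
    ring
  have hW : S * S - (1 + C (-(2 * u)) * X + C v * X ^ 2) = 0 := by
    apply ode_zero (-(2 * u)) v
    · simp [hS]
    · have dW : d⁄dX _ (S * S - (1 + C (-(2 * u)) * X + C v * X ^ 2))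
          = 2 * S * d⁄dX _ S - (C (-(2 * u)) + 2 * C v * X) := by
        rw [pow_two X]
        simp only [map_sub, map_add, Derivation.leibniz, derivative_C, derivative_X, smul_eq_mul,
          Derivation.map_one_eq_zero]
        ring
      rw [dW, dS]
      simp only [map_mul, map_neg, C2, Cu, Cv] at hode ⊢ hS
      generalize d⁄dX _ F = G at *
      linear_combination (-4 * S * C y) * hode + (2 * S * (- (1 + C y) + (1 - C y) ^ 2 * X)) * (-hS)
  have h4 : (4 * C y * X : (Polynomial ℚ)⟦X⟧) *
      (X + C u * (X * F) + C y * (X * (F * F)) - F) = 0 := by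
    rw [← hW, hS]
    simp only [map_mul, map_neg, C2, Cu, Cv]
    ring
  have hne : (4 * C y * X : (Polynomial ℚ)⟦X⟧) ≠ 0 := by
    intro h
    have := congrArg (coeff 1) h
    have e4 : (4 : (Polynomial ℚ)⟦X⟧) = C 4 := (map_ofNat _ 4).symm
    rw [e4, mul_assoc, coeff_C_mul, coeff_C_mul] at this
    simp [hy] at this
  have := (mul_eq_zero.mp h4).resolve_left hne
  linear_combination -this

open Polynomial in
theorem nar_conv (n : ℕ) (hn : 1 ≤ n) :
    nar (n + 1) = (1 + X) * nar n + X * ∑ k ∈ Finset.Ico 1 n, nar k * nar (n - k) := by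
  have h := congrArg (PowerSeries.coeff (n + 1)) (nar_gf _ rfl _ rfl (1 + X) _ rfl rfl)
  rw [map_add, map_add] at h
  simp only [PowerSeries.coeff_C_mul, PowerSeries.coeff_succ_X_mul,
    PowerSeries.coeff_mk] at h
  rw [PowerSeries.coeff_X, if_neg (by omega), zero_add] at h
  rw [h, PowerSeries.coeff_mul,
    Finset.Nat.sum_antidiagonal_eq_sum_range_succ_mk, Finset.sum_range_succ,
    Finset.range_eq_Ico, Finset.sum_eq_sum_Ico_succ_bot (by omega)]
  simp [nar_zero]

theorem stmt_8 (P : ℕ → Polynomial ℚ)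
    (hP : ∀ n : ℕ, 1 ≤ n → P n = ∑ k ∈ Finset.range n,
      Polynomial.C ((1 : ℚ) / n * (n.choose k : ℚ) * (n.choose (k + 1) : ℚ)) *
        (1 + Polynomial.X) ^ k) :
    ∀ n : ℕ, 1 ≤ n →
      P (n + 1) = (2 + Polynomial.X) * P n +
        (1 + Polynomial.X) * ∑ k ∈ Finset.Ico 1 n, P k * P (n - k) := by
  intro n hn
  have hc : ∀ m, 1 ≤ m → P m = Polynomial.aeval (1 + Polynomial.X : Polynomial ℚ) (nar m) := by
    intro m hm
    rw [hP m hm, nar, map_sum]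
    refine Finset.sum_congr rfl fun k _ => ?_
    rw [map_mul (Polynomial.aeval _), map_pow, Polynomial.aeval_X, Polynomial.aeval_C]
    rfl
  have hs : ∑ k ∈ Finset.Ico 1 n, P k * P (n - k) =
      Polynomial.aeval (1 + Polynomial.X : Polynomial ℚ)
        (∑ k ∈ Finset.Ico 1 n, nar k * nar (n - k)) := by
    rw [map_sum]
    refine Finset.sum_congr rfl fun k hk => ?_
    rw [Finset.mem_Ico] at hk
    rw [map_mul, hc k hk.1, hc (n - k) (by omega)]
  rw [hs, hc n hn, hc (n + 1) (by omega), nar_conv n hn]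
  simp only [map_add, map_mul, map_one, Polynomial.aeval_X]
  ring
end

section
/- Let Cat_m = (1/(m+1))·C(2m,m) denote the Catalan numbers. For all integers n ≥ k ≥ 1, the k×k Hankel determinant det( Cat_{n+k−i−j} )_{1 ≤ i,j ≤ k} equals Π_{1 ≤ i ≤ j ≤ n−1−k} (2k + i + j)/(i + j), where the product is interpreted as 1 when n − 1 − k ≤ 0. -/
def rf (a : ℚ) (n : ℕ) : ℚ := ∏ t ∈ Finset.range n, (a + t)

lemma rf_zero (a : ℚ) : rf a 0 = 1 := by simp [rf]

lemma rf_succ (a : ℚ) (n : ℕ) : rf a (n + 1) = rf a n * (a + n) := by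
  simp [rf, Finset.prod_range_succ]

lemma rf_succ' (a : ℚ) (n : ℕ) : rf a (n + 1) = a * rf (a + 1) n := by
  simp only [rf, Finset.prod_range_succ', Nat.cast_zero, add_zero]
  rw [mul_comm]
  congr 1
  apply Finset.prod_congr rfl
  intro t _
  push_cast
  ring

lemma rf_pos {a : ℚ} (ha : 0 < a) (n : ℕ) : 0 < rf a n := by
  apply Finset.prod_pos
  intro t _
  positivity

lemma det_rf (k : ℕ) : ∀ (a b : ℚ), 0 < b →
    Matrix.det (Matrix.of fun i j : Fin (k + 1) => rf a ((i : ℕ) + j) / rf b ((i : ℕ) + j)) =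
    ∏ i ∈ Finset.range (k + 1), ((i.factorial : ℚ) * rf a i * rf (b - a) i / rf b (k + i)) := by
  induction k with
  | zero => intro a b hb; simp [rf_zero]
  | succ k ih =>
    intro a b hb
    let B : Matrix (Fin (k + 2)) (Fin (k + 2)) ℚ := Matrix.of fun i j =>
      Fin.cases (motive := fun _ => ℚ) (rf a j / rf b j)
        (fun i' : Fin (k + 1) => (a * (b - a) / (b * (b + 1)) / (b + i')) *
          ((j : ℕ) * (rf (a + 1) ((i' : ℕ) + j - 1) / rf (b + 2) ((i' : ℕ) + j - 1)))) i
    have e1 : Matrix.det (Matrix.of fun i j : Fin (k + 2) =>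
        rf a ((i : ℕ) + j) / rf b ((i : ℕ) + j)) = B.det := by
      apply Matrix.det_eq_of_forall_row_eq_smul_add_pred (fun i => (a + i) / (b + i))
      · intro j
        simp [B]
      · intro i j
        simp only [B, Matrix.of_apply, Fin.cases_succ, Fin.val_succ, Fin.val_castSucc]
        rcases Nat.eq_zero_or_pos (j : ℕ) with hj | hj
        · have h1 := (rf_pos hb (i : ℕ)).ne'
          have h2 : (b + (i : ℕ)) ≠ 0 := by positivity
          simp only [hj, add_zero, rf_succ, Nat.cast_zero, zero_mul, mul_zero, zero_add]
          field_simp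
        · obtain ⟨j', hj'⟩ : ∃ j', (j : ℕ) = j' + 1 := ⟨j - 1, by omega⟩
          rw [hj']
          have t1 : (i : ℕ) + 1 + (j' + 1) = ((i : ℕ) + j') + 1 + 1 := by ring
          have t2 : (i : ℕ) + (j' + 1) = ((i : ℕ) + j') + 1 := by ring
          have t3 : (i : ℕ) + (j' + 1) - 1 = (i : ℕ) + j' := by omega
          rw [t1, t3, t2]
          generalize hp : (i : ℕ) + j' = p
          have hpq : (p : ℚ) = (i : ℕ) + j' := by rw [← hp]; push_cast; ring
          have b1 : rf b (p + 1 + 1) = b * (b + 1) * rf (b + 2) p := by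
            rw [rf_succ', rf_succ', add_assoc b 1 1]; norm_num [mul_assoc]
          have b2 : rf b (p + 1) = rf b (p + 1 + 1) / (b + (p + 1)) := by
            have : b + ((p : ℚ) + 1) ≠ 0 := by positivity
            rw [rf_succ b (p + 1)]; push_cast; field_simp
          rw [b2, b1, rf_succ a (p + 1), rf_succ' a p]
          have h1 := (rf_pos (show 0 < b + 2 by positivity) p).ne'
          have h2 : (b + (i : ℕ)) ≠ 0 := by positivity
          have h3 : b + ((p : ℚ) + 1) ≠ 0 := by positivity
          field_simp
          push_cast
          rw [hpq]
          ring
    rw [e1, Matrix.det_succ_column_zero, Fin.sum_univ_succ]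
    have e2 : ∀ i : Fin (k + 1), B i.succ 0 = 0 := by
      intro i; simp [B]
    have e3 : B 0 0 = 1 := by simp [B, rf_zero]
    have e4 : B.submatrix (Fin.succAbove 0) Fin.succ = Matrix.of fun i j : Fin (k + 1) =>
        (a * (b - a) / (b * (b + 1)) / (b + (i : ℕ))) *
          (Matrix.of fun i j : Fin (k + 1) => (((j : ℕ) : ℚ) + 1) *
            (Matrix.of fun i j : Fin (k + 1) =>
              rf (a + 1) ((i : ℕ) + j) / rf (b + 2) ((i : ℕ) + j)) i j) i j := by
      ext i j
      simp [B]
    simp only [e2, e3, mul_zero, zero_mul, Finset.sum_const_zero, add_zero, mul_one, Fin.val_zero,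
      pow_zero, one_mul]
    rw [e4, Matrix.det_mul_column (fun i : Fin (k + 1) =>
        (a * (b - a) / (b * (b + 1)) / (b + (i : ℕ)))),
      Matrix.det_mul_row (fun j : Fin (k + 1) => (((j : ℕ) : ℚ) + 1)),
      ih (a + 1) (b + 2) (by positivity),
      Fin.prod_univ_eq_prod_range (fun i => a * (b - a) / (b * (b + 1)) / (b + (i : ℚ))),
      Fin.prod_univ_eq_prod_range (fun i => ((i : ℚ) + 1)),
      ← Finset.prod_mul_distrib, Finset.prod_div_distrib]
    rw [Finset.prod_range_succ' _ (k + 1)]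
    have e5 : ∏ i ∈ Finset.range (k + 1), (b + (i : ℚ)) = rf b (k + 1) := rfl
    rw [e5, div_mul_eq_mul_div, ← Finset.prod_mul_distrib]
    simp only [rf_zero, Nat.factorial_zero, Nat.cast_one, mul_one, add_zero]
    rw [mul_one_div]
    congr 1
    apply Finset.prod_congr rfl
    intro i _
    have b1 : rf b (k + 1 + (i + 1)) = b * (b + 1) * rf (b + 2) (k + i) := by
      rw [show k + 1 + (i + 1) = k + i + 1 + 1 by ring, rf_succ', rf_succ', add_assoc b 1 1]
      norm_num [mul_assoc]
    have h1 := (rf_pos (show 0 < b + 2 by positivity) (k + i)).ne'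
    rw [b1, rf_succ' a, rf_succ' (b - a), Nat.factorial_succ,
      show b + 2 - (a + 1) = b - a + 1 by ring]
    push_cast
    field_simp

def cq (N : ℕ) : ℚ := (1 : ℚ) / ((N : ℚ) + 1) * ((2 * N).choose N : ℚ)

lemma cq_succ (N : ℕ) : cq (N + 1) = cq N * (4 * (N + 1 / 2) / (N + 2)) := by
  have h := Nat.succ_mul_centralBinom_succ N
  simp only [Nat.centralBinom] at h
  have h' : ((N : ℚ) + 1) * ((2 * (N + 1)).choose (N + 1) : ℚ) =
    2 * (2 * N + 1) * ((2 * N).choose N : ℚ) := by exact_mod_cast h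
  have h2 : ((2 * (N + 1)).choose (N + 1) : ℚ) =
      2 * (2 * N + 1) * ((2 * N).choose N : ℚ) / ((N : ℚ) + 1) := by
    field_simp
    linarith
  simp only [cq]
  rw [h2]
  push_cast
  field_simp
  ring

lemma cq_add (m p : ℕ) : cq (m + p) = cq m * 4 ^ p * (rf (m + 1 / 2) p / rf (m + 2) p) := by
  induction p with
  | zero => simp [rf_zero]
  | succ p ih =>
    rw [← add_assoc, cq_succ, ih, rf_succ, rf_succ]
    have := (rf_pos (show 0 < (m : ℚ) + 2 by positivity) p).ne'
    push_cast
    field_simp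
    ring

def G (m k : ℕ) : ℚ := ∏ i ∈ Finset.range (k + 1),
  (cq m * 4 ^ i * 4 ^ i *
   ((i.factorial : ℚ) * rf (m + 1 / 2) i * rf (3 / 2) i / rf (m + 2) (k + i)))

lemma det_cq (m k : ℕ) :
    Matrix.det (Matrix.of fun i j : Fin (k + 1) => cq (m + ((i : ℕ) + j))) = G m k := by
  have e : (Matrix.of fun i j : Fin (k + 1) => cq (m + ((i : ℕ) + j))) =
      Matrix.of fun i j : Fin (k + 1) => (cq m * 4 ^ (i : ℕ)) *
          (Matrix.of fun i j : Fin (k + 1) => ((4 : ℚ) ^ (j : ℕ)) *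
            (Matrix.of fun i j : Fin (k + 1) =>
              rf (m + 1 / 2) ((i : ℕ) + j) / rf (m + 2) ((i : ℕ) + j)) i j) i j := by
    ext i j
    simp only [Matrix.of_apply, cq_add, pow_add]
    ring
  rw [e, Matrix.det_mul_column (fun i : Fin (k + 1) => cq m * 4 ^ (i : ℕ)),
    Matrix.det_mul_row (fun j : Fin (k + 1) => (4 : ℚ) ^ (j : ℕ)),
    det_rf k _ _ (by positivity),
    Fin.prod_univ_eq_prod_range (fun i => cq m * 4 ^ i),
    Fin.prod_univ_eq_prod_range (fun i => (4 : ℚ) ^ i),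
    ← Finset.prod_mul_distrib, ← Finset.prod_mul_distrib, G]
  apply Finset.prod_congr rfl
  intro i _
  rw [show (m : ℚ) + 2 - (m + 1 / 2) = 3 / 2 by ring]
  ring

lemma G_step (m k : ℕ) : G (m + 1) k = G m k *
    ∏ i ∈ Finset.range (k + 1), (4 * (m + 1 / 2 + i) / (m + 2 + k + i) : ℚ) := by
  rw [G, G, ← Finset.prod_mul_distrib]
  apply Finset.prod_congr rfl
  intro i _
  have ha : (0 : ℚ) < m + 1 / 2 := by positivity
  have hb : (0 : ℚ) < m + 2 := by positivity
  have h1 : rf ((m + 1 : ℕ) + 1 / 2) i = rf (m + 1 / 2) i * (m + 1 / 2 + i) / (m + 1 / 2) := by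
    rw [← rf_succ, rf_succ']
    rw [show ((m + 1 : ℕ) : ℚ) + 1 / 2 = m + 1 / 2 + 1 by push_cast; ring]
    field_simp
  have h2 : rf ((m + 1 : ℕ) + 2) (k + i) =
      rf (m + 2) (k + i) * (m + 2 + k + i) / (m + 2) := by
    have := rf_succ (m + 2) (k + i)
    rw [rf_succ'] at this
    rw [show ((m + 1 : ℕ) : ℚ) + 2 = m + 2 + 1 by push_cast; ring]
    rw [eq_div_iff hb.ne', mul_comm, this]
    push_cast
    ring
  have h3 := (rf_pos hb (k + i)).ne'
  rw [h1, h2, cq_succ]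
  field_simp

lemma ratio (m k : ℕ) :
    ∏ i ∈ Finset.range k, (4 * (m + 1 / 2 + i) / (m + 1 + k + i) : ℚ) =
    ∏ i ∈ Finset.range m, ((2 * k + (i + 1) + m : ℚ) / (i + 1 + m)) := by
  have L : ∀ k : ℕ, ∏ i ∈ Finset.range k, (4 * (m + 1 / 2 + i) / (m + 1 + k + i) : ℚ) =
      ((2 * k + 2 * m).factorial * m.factorial) / ((2 * k + m).factorial * (2 * m).factorial) := by
    intro k
    have A : ∏ i ∈ Finset.range k, (4 * (m + 1 / 2 + i) : ℚ) =
      ((2 * k + 2 * m).factorial * m.factorial) / ((m + k).factorial * (2 * m).factorial) := by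
      induction k with
      | zero => simp [Nat.factorial_ne_zero, mul_comm]
      | succ k ih =>
        rw [Finset.prod_range_succ, ih, show 2 * (k + 1) + 2 * m = (2 * k + 2 * m) + 1 + 1 by ring,
          show m + (k + 1) = (m + k) + 1 by ring]
        simp only [Nat.factorial_succ]
        push_cast
        field_simp
        ring
    have B : ∀ q : ℕ, ∏ i ∈ Finset.range q, (m + 1 + k + i : ℚ) =
        (m + k + q).factorial / (m + k).factorial := by
      intro q
      induction q with
      | zero => simp [Nat.factorial_ne_zero]
      | succ q ih =>
        rw [Finset.prod_range_succ, ih, ← add_assoc]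
        simp only [Nat.factorial_succ]
        push_cast
        field_simp
        ring
    rw [Finset.prod_div_distrib, A, B, show m + k + k = 2 * k + m by ring]
    field_simp
  rw [L]
  have C : ∀ c q : ℕ, ∏ i ∈ Finset.range q, ((c : ℚ) + (i + 1)) =
      (c + q).factorial / c.factorial := by
    intro c q
    induction q with
    | zero => simp [Nat.factorial_ne_zero]
    | succ q ih =>
      rw [Finset.prod_range_succ, ih, show c + (q + 1) = c + q + 1 by ring]
      simp only [Nat.factorial_succ]
      push_cast
      field_simp
      ring
  have C1 := C (2 * k + m) m
  have C2 := C m m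
  rw [Finset.prod_div_distrib]
  rw [show ∏ i ∈ Finset.range m, (2 * (k : ℚ) + (i + 1) + m) =
    ∏ i ∈ Finset.range m, (((2 * k + m : ℕ) : ℚ) + (i + 1)) by
      apply Finset.prod_congr rfl; intro i _; push_cast; ring, C1,
    show ∏ i ∈ Finset.range m, ((i : ℚ) + 1 + m) =
    ∏ i ∈ Finset.range m, ((m : ℚ) + (i + 1)) by
      apply Finset.prod_congr rfl; intro i _; ring, C2,
    show 2 * k + m + m = 2 * k + 2 * m by ring, show m + m = 2 * m by ring]
  field_simp

lemma rf_two (q : ℕ) : rf 2 q = (q + 1).factorial := by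
  induction q with
  | zero => simp [rf_zero]
  | succ q ih =>
    rw [rf_succ, ih, Nat.factorial_succ (q + 1)]; push_cast; ring

lemma rf_half (q : ℕ) : rf (1 / 2) q = (2 * q).factorial / (4 ^ q * q.factorial) := by
  induction q with
  | zero => simp [rf_zero]
  | succ q ih =>
    rw [rf_succ, ih, show 2 * (q + 1) = 2 * q + 1 + 1 by ring]
    simp only [Nat.factorial_succ, pow_succ]; push_cast; field_simp; ring

lemma rf_three_half (q : ℕ) :
    rf (3 / 2) q = (2 * q + 1).factorial / (4 ^ q * q.factorial) := by
  induction q with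
  | zero => simp [rf_zero]
  | succ q ih =>
    rw [rf_succ, ih, show 2 * (q + 1) + 1 = 2 * q + 1 + 1 + 1 by ring]
    simp only [Nat.factorial_succ, pow_succ]; push_cast; field_simp; ring

lemma G_zero (k : ℕ) : G 0 k = 1 := by
  have hG : ∀ k, G 0 k = ∏ i ∈ Finset.range (k + 1),
      (((2 * i).factorial * (2 * i + 1).factorial : ℚ) /
        (i.factorial * (k + i + 1).factorial)) := by
    intro k
    rw [G]
    apply Finset.prod_congr rfl
    intro i _
    have : cq 0 = 1 := by simp [cq]
    rw [this]
    simp only [Nat.cast_zero, zero_add]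
    rw [rf_half, rf_two, rf_three_half]
    field_simp
  have B : ∀ k q : ℕ, ∏ i ∈ Finset.range q, (((k + i + 1 : ℕ).factorial : ℚ) /
      (k + 1 + i + 1 : ℕ).factorial) = (k + 1).factorial / (k + 1 + q).factorial := by
    intro k q
    induction q with
    | zero => simp [Nat.factorial_ne_zero]
    | succ q ih =>
      rw [Finset.prod_range_succ, ih, show k + q + 1 = k + 1 + q by ring,
        show k + 1 + (q + 1) = k + 1 + q + 1 by ring]
      field_simp
  induction k with
  | zero => rw [hG]; simp
  | succ k ih =>
    have h : G 0 (k + 1) = G 0 k * (∏ i ∈ Finset.range (k + 1), (((k + i + 1 : ℕ).factorial : ℚ) /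
      (k + 1 + i + 1 : ℕ).factorial)) * (((2 * (k + 1)).factorial * (2 * (k + 1) + 1).factorial : ℚ) /
        ((k + 1).factorial * (k + 1 + (k + 1) + 1).factorial)) := by
      rw [hG, hG, Finset.prod_range_succ, ← Finset.prod_mul_distrib]
      congr 1
      apply Finset.prod_congr rfl
      intro i _
      field_simp
    rw [h, ih, B, show k + 1 + (k + 1) = 2 * (k + 1) by ring]
    field_simp

lemma G_eq (m k : ℕ) : G m k = ∏ i ∈ Finset.Icc 1 (m - 1), ∏ j ∈ Finset.Icc i (m - 1),
        ((2 * (k + 1) + i + j : ℕ) : ℚ) / ((i + j : ℕ) : ℚ) := by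
  induction m with
  | zero => simp [G_zero]
  | succ m ih =>
    have hs : ∏ i ∈ Finset.range (k + 1), (4 * (m + 1 / 2 + i) / (m + 2 + k + i) : ℚ) =
        ∏ i ∈ Finset.Icc 1 m, ((2 * (k + 1) + i + m : ℕ) : ℚ) / ((i + m : ℕ) : ℚ) := by
      have := ratio m (k + 1)
      rw [show ∏ i ∈ Finset.range (k + 1), (4 * (m + 1 / 2 + i) / (m + 2 + k + i) : ℚ) =
        ∏ i ∈ Finset.range (k + 1), (4 * (m + 1 / 2 + i) / (m + 1 + (k + 1 : ℕ) + i) : ℚ) by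
          apply Finset.prod_congr rfl; intro i _; push_cast; ring_nf, this]
      rw [← Finset.Ico_add_one_right_eq_Icc, Finset.prod_Ico_eq_prod_range]
      apply Finset.prod_congr rfl
      intro i _
      push_cast
      ring_nf
    rw [G_step, ih, hs, Nat.add_sub_cancel]
    rcases m with _ | m
    · simp
    · rw [Nat.add_sub_cancel, Finset.prod_Icc_succ_top (by omega), Finset.prod_Icc_succ_top (by omega)]
      simp only [Finset.Icc_self, Finset.prod_singleton]
      rw [← mul_assoc, ← Finset.prod_mul_distrib]
      congr 1
      apply Finset.prod_congr rfl
      intro i hi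
      rw [Finset.mem_Icc] at hi
      rw [Finset.prod_Icc_succ_top (by omega)]

theorem stmt_18 (n k : ℕ) (hk : 1 ≤ k) (hn : k ≤ n) :
    Matrix.det (Matrix.of fun i j : Fin k =>
        ((1 : ℚ) / ((n + k - (i : ℕ) - (j : ℕ) - 2 : ℕ) + 1) *
          ((2 * (n + k - (i : ℕ) - (j : ℕ) - 2)).choose (n + k - (i : ℕ) - (j : ℕ) - 2) : ℚ))) =
    ∏ i ∈ Finset.Icc 1 (n - 1 - k), ∏ j ∈ Finset.Icc i (n - 1 - k),
        ((2 * k + i + j : ℕ) : ℚ) / ((i + j : ℕ) : ℚ) := by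
  obtain ⟨k, rfl⟩ : ∃ k', k = k' + 1 := ⟨k - 1, by omega⟩
  obtain ⟨m, rfl⟩ : ∃ m, n = m + (k + 1) := ⟨n - (k + 1), by omega⟩
  rw [show m + (k + 1) - 1 - (k + 1) = m - 1 by omega, ← G_eq, ← det_cq,
    ← Matrix.det_submatrix_equiv_self Fin.revPerm]
  congr 1
  ext i j
  simp only [Matrix.submatrix_apply, Matrix.of_apply, Fin.revPerm_apply, Fin.val_rev, cq]
  have hi := i.isLt
  have hj := j.isLt
  rw [show m + (k + 1) + (k + 1) - (k + 1 - ((i : ℕ) + 1)) - (k + 1 - ((j : ℕ) + 1)) - 2 =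
    m + ((i : ℕ) + j) by omega]
end
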